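/- arXiv:2508.05400 — 8 statements merged into one kernel-verified Lean document; each statement's English description precedes it below -/
import Mathlib

section
/- Let A ∈ ℝ^{n×n}, U ∈ ℝ^{n×k}, u ∈ ℝ^n, b ∈ ℝ^k, B ∈ ℝ^{k×k}, and Ω ∈ ℝ^{d×n} satisfy A·U = U·B + u·bᵀ, where the n×(k+1) matrix (U u) is sketch-orthonormal with respect to Ω. Then B equals the sketched Rayleigh quotient: (ΩU)ᵀ·Ω·A·U = B. -/
open Matrix

/-- `M` is sketch-orthonormal w.r.t. `Ω` if `(ΩM)ᵀ(ΩM) = I`. -/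
def SketchOrthonormal {d n : ℕ} {m : Type*} [Fintype m] [DecidableEq m]
    (Ω : Matrix (Fin d) (Fin n) ℝ) (M : Matrix (Fin n) m ℝ) : Prop :=
  (Ω * M)ᵀ * (Ω * M) = 1

theorem stmt_2 {n k d : ℕ} (A : Matrix (Fin n) (Fin n) ℝ)
    (U : Matrix (Fin n) (Fin k) ℝ) (u : Fin n → ℝ) (b : Fin k → ℝ)
    (B : Matrix (Fin k) (Fin k) ℝ) (Ω : Matrix (Fin d) (Fin n) ℝ)
    (hdec : A * U = U * B + vecMulVec u b)
    (horth : SketchOrthonormal Ω (fromCols U (replicateCol (Fin 1) u))) :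
    (Ω * U)ᵀ * (Ω * A * U) = B := by
  unfold SketchOrthonormal at horth
  rw [mul_fromCols, transpose_fromCols, fromRows_mul_fromCols, ← fromBlocks_one,
    fromBlocks_inj] at horth
  obtain ⟨h1, h2, -, -⟩ := horth
  have hv : vecMulVec u b = replicateCol (Fin 1) u * replicateRow (Fin 1) b := by
    ext i j
    simp [Matrix.mul_apply, vecMulVec_apply]
  rw [Matrix.mul_assoc Ω A U, hdec, hv, Matrix.mul_add, Matrix.mul_add,
    ← Matrix.mul_assoc Ω U B, ← Matrix.mul_assoc _ (Ω * U) B, h1,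
    ← Matrix.mul_assoc Ω (replicateCol (Fin 1) u), ← Matrix.mul_assoc _ (Ω * _), h2]
  simp
end

section
/- Let A ∈ ℝ^{n×n}, U ∈ ℝ^{n×k}, u ∈ ℝ^n, b ∈ ℝ^k, B ∈ ℝ^{k×k} satisfy A·U = U·B + u·bᵀ, with U sketch-orthonormal with respect to Ω ∈ ℝ^{d×n}. Set g := (ΩU)ᵀ·Ω·u, α := ‖Ω(u − U·g)‖, and assume α ≠ 0. Define ũ := (u − U·g)/α. Then: (i) (ΩU)ᵀ·Ω·ũ = 0, i.e., ũ is sketch-orthogonal to U; (ii) ‖Ω·ũ‖ = 1; and (iii) A·U = U·(B + g·bᵀ) + ũ·(α·b)ᵀ, so that (U ũ) is sketch-orthonormal and the translated relation is again a Krylov decomposition with the same column span of (U u). -/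
open Matrix

/-- Euclidean (ℓ²) norm of a vector in `Fin n → ℝ`. -/
noncomputable def eNorm {n : ℕ} (x : Fin n → ℝ) : ℝ :=
  ‖(WithLp.equiv 2 (Fin n → ℝ)).symm x‖

theorem stmt_5 {n k d : ℕ} (A : Matrix (Fin n) (Fin n) ℝ)
    (U : Matrix (Fin n) (Fin k) ℝ) (u : Fin n → ℝ) (b : Fin k → ℝ)
    (B : Matrix (Fin k) (Fin k) ℝ) (Ω : Matrix (Fin d) (Fin n) ℝ)
    (hdec : A * U = U * B + vecMulVec u b)
    (horth : SketchOrthonormal Ω U)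
    (g : Fin k → ℝ) (hg : g = (Ω * U)ᵀ.mulVec (Ω.mulVec u))
    (α : ℝ) (hα : α = eNorm (Ω.mulVec (u - U.mulVec g))) (hα0 : α ≠ 0)
    (ut : Fin n → ℝ) (hut : ut = α⁻¹ • (u - U.mulVec g)) :
    (Ω * U)ᵀ.mulVec (Ω.mulVec ut) = 0 ∧
      eNorm (Ω.mulVec ut) = 1 ∧
      A * U = U * (B + vecMulVec g b) + vecMulVec ut (α • b) ∧
      SketchOrthonormal Ω (fromCols U (replicateCol (Fin 1) ut)) ∧
      LinearMap.range (fromCols U (replicateCol (Fin 1) ut)).mulVecLin =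
        LinearMap.range (fromCols U (replicateCol (Fin 1) u)).mulVecLin := by
  have hW : (Ω * U)ᵀ * (Ω * U) = 1 := horth
  have h1 : (Ω * U)ᵀ.mulVec (Ω.mulVec ut) = 0 := by
    rw [hut, mulVec_smul, mulVec_smul, mulVec_sub, mulVec_sub, ← hg, mulVec_mulVec g Ω U,
      mulVec_mulVec, hW, one_mulVec, sub_self, smul_zero]
  have hn : ∀ {m : ℕ} (c : ℝ) (x : Fin m → ℝ), eNorm (c • x) = |c| * eNorm x := by
    intro m c x
    have h : (WithLp.equiv 2 (Fin m → ℝ)).symm (c • x)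
      = c • (WithLp.equiv 2 (Fin m → ℝ)).symm x := rfl
    unfold eNorm
    rw [h, norm_smul, Real.norm_eq_abs]
  have hpos : 0 ≤ α := by rw [hα]; exact norm_nonneg _
  have h2 : eNorm (Ω.mulVec ut) = 1 := by
    rw [hut, mulVec_smul, hn, ← hα, abs_of_nonneg (inv_nonneg.mpr hpos), inv_mul_cancel₀ hα0]
  have hu : u = U.mulVec g + α • ut := by
    rw [hut, smul_smul, mul_inv_cancel₀ hα0, one_smul]
    abel
  have h2' : Ω.mulVec ut ⬝ᵥ Ω.mulVec ut = 1 := by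
    have h := EuclideanSpace.real_norm_sq_eq ((WithLp.equiv 2 (Fin d → ℝ)).symm (Ω.mulVec ut))
    unfold eNorm at h2
    rw [h2] at h
    rw [dotProduct]
    simp only [← sq]
    simpa using h.symm
  have hcol : ∀ (v : Fin n → ℝ) (x : Fin k ⊕ Fin 1 → ℝ),
      (fromCols U (replicateCol (Fin 1) v)).mulVec x
        = U.mulVec (x ∘ Sum.inl) + x (Sum.inr 0) • v := by
    intro v x
    rw [fromCols_mulVec]
    congr 1
    ext i
    simp [mulVec, dotProduct, mul_comm]
  refine ⟨h1, h2, ?_, ?_, ?_⟩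
  · rw [hdec, Matrix.mul_add, mul_vecMulVec, add_assoc, vecMulVec_smul, ← smul_vecMulVec,
      ← add_vecMulVec, ← hu]
  · unfold SketchOrthonormal
    have e : Ω * replicateCol (Fin 1) ut = replicateCol (Fin 1) (Ω.mulVec ut) := by
      rw [replicateCol_mulVec]
    have e1 : (Ω * U)ᵀ * replicateCol (Fin 1) (Ω.mulVec ut) = 0 := by
      rw [← replicateCol_mulVec, h1]; rfl
    have e2 : (replicateCol (Fin 1) (Ω.mulVec ut))ᵀ * (Ω * U) = 0 := by
      have := congrArg transpose e1
      simpa using this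
    have e3 : (replicateCol (Fin 1) (Ω.mulVec ut))ᵀ * replicateCol (Fin 1) (Ω.mulVec ut) = 1 := by
      ext i j
      rw [Subsingleton.elim i j, one_apply_eq, ← h2']
      rfl
    rw [mul_fromCols, transpose_fromCols, fromRows_mul_fromCols, e, hW, e1, e2, e3,
      fromBlocks_one]
  · apply le_antisymm
    · rintro _ ⟨x, rfl⟩
      refine ⟨Sum.elim (x ∘ Sum.inl - (α⁻¹ * x (Sum.inr 0)) • g) (fun _ => α⁻¹ * x (Sum.inr 0)), ?_⟩
      rw [mulVecLin_apply, mulVecLin_apply, hcol, hcol, hut]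
      simp only [Sum.elim_comp_inl, Sum.elim_inr, mulVec_sub, mulVec_smul]
      module
    · rintro _ ⟨x, rfl⟩
      refine ⟨Sum.elim (x ∘ Sum.inl + x (Sum.inr 0) • g) (fun _ => α * x (Sum.inr 0)), ?_⟩
      rw [mulVecLin_apply, mulVecLin_apply, hcol, hcol]
      simp only [Sum.elim_comp_inl, Sum.elim_inr, mulVec_add, mulVec_smul]
      conv_rhs => rw [hu]
      module
end

section
/- Let A ∈ ℝ^{n×n} and let A·U = U·B + u·bᵀ be a Krylov decomposition of order k, where the n×(k+1) matrix (U u) has linearly independent columns and B ∈ ℝ^{k×k} has rank k. Let Ω ∈ ℝ^{d×n} be an ε-embedding (0 ≤ ε < 1) for the column span of (U u). Then there exist V ∈ ℝ^{n×k}, v ∈ ℝ^n, an upper-Hessenberg matrix H ∈ ℝ^{k×k}, and β ∈ ℝ such that (V v) is sketch-orthonormal with respect to Ω, A·V = V·H + β·v·e_kᵀ, and the column span of (V v) equals the column span of (U u). -/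
open Matrix

/-- `Ω` is an ε-embedding for the set `K ⊆ ℝⁿ`. -/
def IsEpsEmbedding {d n : ℕ} (Ω : Matrix (Fin d) (Fin n) ℝ) (ε : ℝ)
    (K : Set (Fin n → ℝ)) : Prop :=
  ∀ x ∈ K, (1 - ε) * eNorm x ^ 2 ≤ eNorm (Ω.mulVec x) ^ 2 ∧
    eNorm (Ω.mulVec x) ^ 2 ≤ (1 + ε) * eNorm x ^ 2

/-- The k-th standard basis vector `e_k` of `ℝ^k` (the last one). -/
def lastBasisVec (k : ℕ) : Fin k → ℝ := fun j => if (j : ℕ) + 1 = k then 1 else 0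

lemma aux_orth {k : ℕ} (w : Fin (k+1) → ℝ) : ∃ (Q : Matrix (Fin (k+1)) (Fin (k+1)) ℝ) (β : ℝ),
    Qᵀ * Q = 1 ∧ w ᵥ* Q = β • (Pi.single (Fin.last k) 1 : Fin (k+1) → ℝ) := by
  by_cases hw : w = 0
  · exact ⟨1, 0, by simp, by simp [hw]⟩
  set W : EuclideanSpace ℝ (Fin (k+1)) := WithLp.toLp 2 w with hW
  have hW0 : W ≠ 0 := by
    intro h
    apply hw
    have := congrArg WithLp.ofLp h
    simpa [hW] using this
  have hn : ‖W‖ ≠ 0 := norm_ne_zero_iff.mpr hW0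
  obtain ⟨b, hb⟩ := Orthonormal.exists_orthonormalBasis_extension_of_card_eq (𝕜 := ℝ)
    (E := EuclideanSpace ℝ (Fin (k+1))) (ι := Fin (k+1)) (by simp)
    (v := fun _ => ‖W‖⁻¹ • W) (s := {Fin.last k}) (by
      rw [orthonormal_iff_ite]
      rintro ⟨i, hi⟩ ⟨j, hj⟩
      simp only [Set.mem_singleton_iff] at hi hj
      subst hi; subst hj
      simp [norm_smul, hn])
  have hb' := hb (Fin.last k) rfl
  have hWb : W = ‖W‖ • b (Fin.last k) := by
    rw [hb', smul_smul, mul_inv_cancel₀ hn, one_smul]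
  have hbo := orthonormal_iff_ite.mp b.orthonormal
  refine ⟨Matrix.of fun i j => b j i, ‖W‖, ?_, ?_⟩
  · ext i j
    have := hbo j i
    simp only [PiLp.inner_apply] at this
    simp only [Matrix.mul_apply, Matrix.transpose_apply, Matrix.of_apply, Matrix.one_apply]
    simpa [eq_comm] using this
  · ext j
    have h1 : w ᵥ* (Matrix.of fun i j => b j i) = fun j => inner ℝ (b j) W := by
      ext j
      simp [Matrix.vecMul, dotProduct, PiLp.inner_apply, hW]
    rw [h1]
    show inner ℝ (b j) W = _
    rw [hWb, inner_smul_right, hbo]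
    simp [Pi.single_apply, hb', norm_smul, hn]

lemma aux_hess : ∀ (k : ℕ) (C : Matrix (Fin k) (Fin k) ℝ) (w : Fin k → ℝ),
    ∃ (Q : Matrix (Fin k) (Fin k) ℝ) (β : ℝ), Qᵀ * Q = 1 ∧ w ᵥ* Q = β • lastBasisVec k ∧
      ∀ i j : Fin k, (j : ℕ) + 1 < (i : ℕ) → (Qᵀ * C * Q) i j = 0
  | 0, C, w => ⟨1, 0, by simp, by ext i; exact i.elim0, fun i => i.elim0⟩
  | k+1, C, w => by
    obtain ⟨Q₁, β, h1, h2⟩ := aux_orth w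
    set D := Q₁ᵀ * C * Q₁ with hD
    obtain ⟨Q₂, β₂, g1, g2, g3⟩ := aux_hess k (D.submatrix Fin.castSucc Fin.castSucc)
      (fun j => D (Fin.last k) j.castSucc)
    let P : Matrix (Fin (k+1)) (Fin (k+1)) ℝ := Matrix.of
      (Fin.lastCases (Pi.single (Fin.last k) 1) (fun i => Fin.lastCases 0 (fun j => Q₂ i j)))
    have p1 : ∀ i j : Fin k, P i.castSucc j.castSucc = Q₂ i j := by intros; simp [P]
    have p2 : ∀ i : Fin k, P i.castSucc (Fin.last k) = 0 := by intros; simp [P]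
    have p3 : ∀ i : Fin k, P (Fin.last k) i.castSucc = 0 := by
      intros; simp [P]
    have p4 : P (Fin.last k) (Fin.last k) = 1 := by simp [P]
    refine ⟨Q₁ * P, β, ?_, ?_, ?_⟩
    · have : (Q₁ * P)ᵀ * (Q₁ * P) = Pᵀ * P := by
        rw [transpose_mul, Matrix.mul_assoc, ← Matrix.mul_assoc Q₁ᵀ, h1, Matrix.one_mul]
      rw [this]
      ext i j
      have g := fun i j => congrFun (congrFun g1 i) j
      simp only [Matrix.mul_apply, Matrix.transpose_apply, Matrix.one_apply] at g
      rw [Matrix.mul_apply, Fin.sum_univ_castSucc]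
      simp only [Matrix.transpose_apply]
      refine Fin.lastCases ?_ (fun i => ?_) i <;> refine Fin.lastCases ?_ (fun j => ?_) j <;>
        simp [p1, p2, p3, p4, g, Matrix.one_apply, Fin.castSucc_ne_last, (Fin.castSucc_ne_last _).symm]
    · rw [← Matrix.vecMul_vecMul, h2]
      ext j
      rw [Matrix.smul_vecMul]
      refine Fin.lastCases ?_ (fun j => ?_) j <;>
      simp [p3, p4, lastBasisVec]
      intro h; exact absurd h (by omega)
    · intro i j hij
      have : (Q₁ * P)ᵀ * C * (Q₁ * P) = Pᵀ * D * P := by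
        rw [transpose_mul, hD]; simp only [Matrix.mul_assoc]
      rw [this]
      revert hij
      refine Fin.lastCases ?_ (fun j => ?_) j
      · intro hij; have := i.2; simp at hij; omega
      refine Fin.lastCases ?_ (fun i => ?_) i
      · intro hij
        have g := congrFun g2 j
        simp only [Matrix.vecMul, dotProduct] at g
        simp only [Matrix.mul_apply, Fin.sum_univ_castSucc, Matrix.transpose_apply, p1, p2, p3, p4]
        simp [g, lastBasisVec]
        intro h; simp at hij; omega
      · intro hij
        have g := g3 i j (by simpa using hij)
        simp only [Matrix.mul_apply, Matrix.transpose_apply, Matrix.submatrix_apply] at g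
        simp only [Matrix.mul_apply, Fin.sum_univ_castSucc, Matrix.transpose_apply, p1, p2, p3, p4]
        simpa using g

lemma aux_range {n k : ℕ} (U V : Matrix (Fin n) (Fin k) ℝ) (u v : Fin n → ℝ)
    (X : Matrix (Fin k) (Fin k) ℝ) (y : Fin k → ℝ) (c : ℝ)
    (hV : V = U * X) (hv : v = U *ᵥ y + c • u) :
    LinearMap.range (fromCols V (replicateCol (Fin 1) v)).mulVecLin ≤
        LinearMap.range (fromCols U (replicateCol (Fin 1) u)).mulVecLin := by
  rintro _ ⟨x, rfl⟩
  refine ⟨Sum.elim (X *ᵥ (x ∘ Sum.inl) + x (Sum.inr 0) • y) (fun _ => x (Sum.inr 0) * c), ?_⟩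
  have hr : ∀ (a : Fin n → ℝ) (t : Fin 1 → ℝ), replicateCol (Fin 1) a *ᵥ t = t 0 • a := by
    intro a t; ext i; simp [Matrix.mulVec, dotProduct, mul_comm]
  simp only [Matrix.mulVecLin_apply, fromCols_mulVec, hr, hV, hv]
  simp [Matrix.mulVec_add, Matrix.mulVec_smul, smul_smul, add_assoc]

lemma aux_eNorm {n : ℕ} (x : Fin n → ℝ) : eNorm x ^ 2 = x ⬝ᵥ x := by
  rw [eNorm, EuclideanSpace.norm_sq_eq]
  simp [dotProduct, ← sq]

open scoped MatrixOrder Matrix.Norms.L2Operator in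
lemma aux_sqrt {k : ℕ} (G : Matrix (Fin k) (Fin k) ℝ) (hG : G.PosDef) :
    ∃ S T : Matrix (Fin k) (Fin k) ℝ, S * T = 1 ∧ T * S = 1 ∧ Sᵀ * G * S = 1 := by
  obtain ⟨R, hR⟩ := CStarAlgebra.nonneg_iff_eq_star_mul_self.mp hG.posSemidef.nonneg
  rw [star_eq_conjTranspose, conjTranspose_eq_transpose_of_trivial] at hR
  have hd : IsUnit R.det := by
    have := hG.det_pos
    rw [hR, det_mul] at this
    exact isUnit_iff_ne_zero.mpr (right_ne_zero_of_mul this.ne')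
  refine ⟨R⁻¹, R, Matrix.nonsing_inv_mul _ hd, Matrix.mul_nonsing_inv _ hd, ?_⟩
  rw [hR, Matrix.mul_assoc, Matrix.mul_assoc, Matrix.mul_nonsing_inv _ hd, Matrix.mul_one,
    ← transpose_mul, Matrix.mul_nonsing_inv _ hd, transpose_one]

theorem stmt_6 {n k d : ℕ} (ε : ℝ) (hε0 : 0 ≤ ε) (hε1 : ε < 1)
    (A : Matrix (Fin n) (Fin n) ℝ) (U : Matrix (Fin n) (Fin k) ℝ)
    (u : Fin n → ℝ) (b : Fin k → ℝ) (B : Matrix (Fin k) (Fin k) ℝ)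
    (Ω : Matrix (Fin d) (Fin n) ℝ)
    (hdec : A * U = U * B + vecMulVec u b)
    (hcols : LinearIndependent ℝ (fun j => (fromCols U (replicateCol (Fin 1) u))ᵀ j))
    (hB : B.rank = k)
    (hemb : IsEpsEmbedding Ω ε (Set.range (fromCols U (replicateCol (Fin 1) u)).mulVec)) :
    ∃ (V : Matrix (Fin n) (Fin k) ℝ) (v : Fin n → ℝ)
      (H : Matrix (Fin k) (Fin k) ℝ) (β : ℝ),
      SketchOrthonormal Ω (fromCols V (replicateCol (Fin 1) v)) ∧
      (∀ i j : Fin k, (j : ℕ) + 1 < (i : ℕ) → H i j = 0) ∧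
      A * V = V * H + β • vecMulVec v (lastBasisVec k) ∧
      LinearMap.range (fromCols V (replicateCol (Fin 1) v)).mulVecLin =
        LinearMap.range (fromCols U (replicateCol (Fin 1) u)).mulVecLin := by
  have hr : ∀ (a : Fin n → ℝ) (t : Fin 1 → ℝ), replicateCol (Fin 1) a *ᵥ t = t 0 • a := by
    intro a t; ext i; simp [Matrix.mulVec, dotProduct, mul_comm]
  -- positivity of the sketched form on the span
  have hpos : ∀ (x : Fin k → ℝ) (t : ℝ), (x ≠ 0 ∨ t ≠ 0) →
      0 < (Ω *ᵥ (U *ᵥ x + t • u)) ⬝ᵥ (Ω *ᵥ (U *ᵥ x + t • u)) := by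
    intro x t hxt
    have hinj := Matrix.mulVec_injective_iff.mpr hcols
    set z : Fin k ⊕ Fin 1 → ℝ := Sum.elim x (fun _ => t) with hz
    have hMz : (fromCols U (replicateCol (Fin 1) u)) *ᵥ z = U *ᵥ x + t • u := by
      rw [fromCols_mulVec, hr]; simp [hz]
    have hz0 : z ≠ 0 := by
      intro h
      rcases hxt with h' | h'
      · apply h'; ext i; simpa [hz] using congrFun h (Sum.inl i)
      · apply h'; simpa [hz] using congrFun h (Sum.inr 0)
    have hne : U *ᵥ x + t • u ≠ 0 := by
      rw [← hMz]; intro h; apply hz0; apply hinj; simpa using h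
    have := (hemb _ ⟨z, rfl⟩).1
    rw [hMz, aux_eNorm, aux_eNorm] at this
    have h2 : 0 < (U *ᵥ x + t • u) ⬝ᵥ (U *ᵥ x + t • u) := by
      refine lt_of_le_of_ne ?_ (fun h => hne (dotProduct_self_eq_zero.mp h.symm))
      exact Finset.sum_nonneg (fun i _ => mul_self_nonneg _)
    nlinarith [mul_pos (sub_pos.mpr hε1) h2]
  have hG : ((Ω * U)ᵀ * (Ω * U)).PosDef := by
    refine Matrix.PosDef.of_dotProduct_mulVec_pos ?_ ?_
    · rw [Matrix.IsHermitian, conjTranspose_eq_transpose_of_trivial, transpose_mul,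
        transpose_transpose]
    · intro x hx
      have := hpos x 0 (Or.inl hx)
      rw [zero_smul, add_zero] at this
      rw [star_trivial, ← mulVec_mulVec, dotProduct_mulVec, vecMul_transpose, ← mulVec_mulVec]
      exact this
  obtain ⟨S, T, hST, hTS, hS⟩ := aux_sqrt _ hG
  set V₀ := U * S with hV₀
  have hU : U = V₀ * T := by rw [hV₀, Matrix.mul_assoc, hST, Matrix.mul_one]
  have hV₀o : (Ω * V₀)ᵀ * (Ω * V₀) = 1 := by
    rw [← hS, hV₀, ← Matrix.mul_assoc Ω U S, transpose_mul (Ω * U)]; simp only [Matrix.mul_assoc]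
  set s := (Ω * V₀)ᵀ *ᵥ (Ω *ᵥ u) with hs
  set v₀ := u - V₀ *ᵥ s with hv₀
  have hv₀o : (Ω * V₀)ᵀ *ᵥ (Ω *ᵥ v₀) = 0 := by
    rw [hv₀, mulVec_sub, mulVec_sub, ← hs, mulVec_mulVec s Ω V₀, mulVec_mulVec s, hV₀o, one_mulVec, sub_self]
  have hv₀p : 0 < (Ω *ᵥ v₀) ⬝ᵥ (Ω *ᵥ v₀) := by
    have := hpos (-(S *ᵥ s)) 1 (Or.inr one_ne_zero)
    have e : U *ᵥ (-(S *ᵥ s)) + (1:ℝ) • u = v₀ := by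
      rw [mulVec_neg, mulVec_mulVec, hv₀, hV₀, one_smul]; abel
    rwa [e] at this
  set γ := Real.sqrt ((Ω *ᵥ v₀) ⬝ᵥ (Ω *ᵥ v₀)) with hγ
  have hγ0 : γ ≠ 0 := (Real.sqrt_pos.mpr hv₀p).ne'
  have hγ2 : γ * γ = (Ω *ᵥ v₀) ⬝ᵥ (Ω *ᵥ v₀) := Real.mul_self_sqrt hv₀p.le
  set v := γ⁻¹ • v₀ with hv
  have hu : u = V₀ *ᵥ s + γ • v := by
    rw [hv, smul_smul, mul_inv_cancel₀ hγ0, one_smul, hv₀]; abel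
  have hvo : (Ω * V₀)ᵀ *ᵥ (Ω *ᵥ v) = 0 := by rw [hv, mulVec_smul, mulVec_smul, hv₀o, smul_zero]
  have hvn : (Ω *ᵥ v) ⬝ᵥ (Ω *ᵥ v) = 1 := by
    rw [hv, mulVec_smul, smul_dotProduct, dotProduct_smul, ← hγ2, smul_eq_mul, smul_eq_mul]
    field_simp
  obtain ⟨Q, β, hQ, hw, hH⟩ := aux_hess k (T * B * S + vecMulVec s (b ᵥ* S)) (γ • (b ᵥ* S))
  have hQ' : Q * Qᵀ = 1 := mul_eq_one_comm.mp hQ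
  have hAV₀ : A * V₀ = V₀ * (T * B * S + vecMulVec s (b ᵥ* S)) + vecMulVec v (γ • (b ᵥ* S)) := by
    rw [hV₀, ← Matrix.mul_assoc, hdec, Matrix.add_mul, vecMulVec_mul, ← hV₀, Matrix.mul_add,
      mul_vecMulVec, vecMulVec_smul, ← smul_vecMulVec, add_assoc, ← add_vecMulVec, ← hu,
      ← Matrix.mul_assoc, ← Matrix.mul_assoc, ← hU]
  refine ⟨V₀ * Q, v, Qᵀ * (T * B * S + vecMulVec s (b ᵥ* S)) * Q, β, ?_, hH, ?_, ?_⟩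
  · have e1 : (Ω * (V₀ * Q))ᵀ * (Ω * (V₀ * Q)) = 1 := by
      rw [← Matrix.mul_assoc Ω V₀ Q, transpose_mul, Matrix.mul_assoc, ← Matrix.mul_assoc (Ω * V₀)ᵀ, hV₀o,
        Matrix.one_mul, hQ]
    have e2 : (Ω * (V₀ * Q))ᵀ *ᵥ (Ω *ᵥ v) = 0 := by
      rw [← Matrix.mul_assoc, transpose_mul, ← mulVec_mulVec, hvo, mulVec_zero]
    have e3 : Ω * replicateCol (Fin 1) v = replicateCol (Fin 1) (Ω *ᵥ v) := by
      rw [replicateCol_mulVec]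
    rw [SketchOrthonormal, mul_fromCols, transpose_fromCols, fromRows_mul_fromCols, e1, e3,
      ← fromBlocks_one]
    have e4 : (Ω * (V₀ * Q))ᵀ * replicateCol (Fin 1) (Ω *ᵥ v) = 0 := by
      rw [← replicateCol_mulVec, e2]; rfl
    congr 1
    · rw [← transpose_transpose ((replicateCol (Fin 1) (Ω *ᵥ v))ᵀ * _), transpose_mul,
        transpose_transpose, e4, transpose_zero]
    · ext i j
      rw [Subsingleton.elim j i, Matrix.one_apply_eq, ← hvn]
      rfl
  · rw [← Matrix.mul_assoc, hAV₀, Matrix.add_mul, vecMulVec_mul, hw, vecMulVec_smul]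
    congr 1
    rw [← Matrix.mul_assoc, ← Matrix.mul_assoc, Matrix.mul_assoc V₀ Q, hQ', Matrix.mul_one]
  · apply le_antisymm
    · refine aux_range _ _ _ _ (S * Q) (-(γ⁻¹ • (S *ᵥ s))) γ⁻¹ (by rw [hV₀, Matrix.mul_assoc]) ?_
      rw [hv, hv₀, mulVec_neg, mulVec_smul, mulVec_mulVec s U S, ← hV₀, smul_sub]; abel
    · refine aux_range _ _ _ _ (Qᵀ * T) (Qᵀ *ᵥ s) γ ?_ ?_
      · rw [← Matrix.mul_assoc, Matrix.mul_assoc V₀, hQ', Matrix.mul_one]; exact hU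
      · rw [mulVec_mulVec, Matrix.mul_assoc, hQ', Matrix.mul_one]; exact hu
end

section
/- Let A ∈ ℝ^{n×n}, let U ∈ ℝ^{n×k} be sketch-orthonormal with respect to Ω ∈ ℝ^{d×n}, and suppose A·U = U·T with T ∈ ℝ^{k×k} upper triangular with diagonal entries (λ₁, …, λ_k). Set u₁ := U·e₁ and define the deflated operator A₁ := (I − u₁·(Ω·u₁)ᵀ·Ω)·A. Then A₁·U = U·(T − e₁·e₁ᵀ·T), where T − e₁·e₁ᵀ·T is upper triangular with diagonal entries (0, λ₂, …, λ_k); thus A₁ admits the same sketch-orthonormal Schur vectors U as A, with eigenvalue λ₁ replaced by 0. -/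
open Matrix

theorem stmt_9 {n k d : ℕ} [NeZero k] (A : Matrix (Fin n) (Fin n) ℝ)
    (U : Matrix (Fin n) (Fin k) ℝ) (T : Matrix (Fin k) (Fin k) ℝ)
    (Ω : Matrix (Fin d) (Fin n) ℝ) (lam : Fin k → ℝ)
    (horth : SketchOrthonormal Ω U)
    (hT : T.BlockTriangular id) (hdiag : ∀ i, T i i = lam i)
    (hSchur : A * U = U * T)
    (u₁ : Fin n → ℝ) (hu₁ : u₁ = fun i => U i 0)
    (A₁ : Matrix (Fin n) (Fin n) ℝ)
    (hA₁ : A₁ = (1 - vecMulVec u₁ (Matrix.vecMul (Ω.mulVec u₁) Ω)) * A)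
    (T' : Matrix (Fin k) (Fin k) ℝ)
    (hT' : T' = T - Matrix.single (0 : Fin k) (0 : Fin k) 1 * T) :
    A₁ * U = U * T' ∧
      T'.BlockTriangular id ∧
      T' 0 0 = 0 ∧
      ∀ i : Fin k, i ≠ 0 → T' i i = lam i := by
  have hw : Matrix.vecMul (Matrix.vecMul (Ω.mulVec u₁) Ω) U = Pi.single (0 : Fin k) 1 := by
    ext j
    have h := congrFun (congrFun horth 0) j
    have hcol : ∀ a, (Ω.mulVec u₁) a = (Ω * U) a 0 := by
      intro a
      rw [hu₁]
      rfl
    rw [Matrix.vecMul_vecMul]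
    have h2 : Matrix.vecMul (Ω.mulVec u₁) (Ω * U) j = ((Ω * U)ᵀ * (Ω * U)) 0 j := by
      simp only [Matrix.vecMul, dotProduct, Matrix.mul_apply (M := (Ω * U)ᵀ),
        Matrix.transpose_apply, hcol]
    rw [h2, h, Matrix.one_apply, Pi.single_apply]
    simp only [eq_comm]
  have hP : vecMulVec u₁ (Matrix.vecMul (Ω.mulVec u₁) Ω) * U
      = U * Matrix.single (0 : Fin k) (0 : Fin k) (1 : ℝ) := by
    rw [Matrix.vecMulVec_mul, hw]
    ext i j
    rw [Matrix.vecMulVec_apply, hu₁]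
    by_cases hj : j = 0
    · subst hj
      simp
    · simp [hj, Ne.symm hj]
  have hrow : ∀ i j, T' i j = if i = 0 then 0 else T i j := by
    intro i j
    rw [hT', Matrix.sub_apply]
    by_cases hi : i = 0
    · subst hi
      simp
    · simp [hi]
  refine ⟨?_, ?_, ?_, ?_⟩
  · rw [hA₁, Matrix.mul_assoc, hSchur, ← Matrix.mul_assoc, Matrix.sub_mul, hP, hT',
      Matrix.one_mul, Matrix.sub_mul, Matrix.mul_sub, Matrix.mul_assoc]
  · intro i j hij
    rw [hrow]
    split_ifs
    · rfl
    · exact hT hij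
  · rw [hrow, if_pos rfl]
  · intro i hi
    rw [hrow, if_neg hi, hdiag]
end

section
/- Let A ∈ ℝ^{n×n}, and let A·(U_q Ũ) = (U_q Ũ)·[[T_qq, T₁₂],[0, T̃]] + u·(b_qᵀ b̃ᵀ) be a partitioned randomized Krylov–Schur factorization, where the n×(k+1) matrix (U_q Ũ u) is sketch-orthonormal with respect to Ω ∈ ℝ^{d×n}, U_q ∈ ℝ^{n×q}, Ũ ∈ ℝ^{n×(k−q)}, T_qq ∈ ℝ^{q×q}, T̃ ∈ ℝ^{(k−q)×(k−q)}, b_q ∈ ℝ^q, b̃ ∈ ℝ^{k−q}. If b_q = 0, then: (i) A·U_q = U_q·T_qq, so the columns of U_q are sketch-orthonormal Schur vectors of A spanning an invariant subspace; and (ii) the deflated decomposition (I − U_q·(Ω·U_q)ᵀ·Ω)·A·Ũ = Ũ·T̃ + u·b̃ᵀ holds. -/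
open Matrix

theorem stmt_12 {n q r d : ℕ} (A : Matrix (Fin n) (Fin n) ℝ)
    (Uq : Matrix (Fin n) (Fin q) ℝ) (Ut : Matrix (Fin n) (Fin r) ℝ)
    (u : Fin n → ℝ) (bq : Fin q → ℝ) (bt : Fin r → ℝ)
    (Tqq : Matrix (Fin q) (Fin q) ℝ) (T12 : Matrix (Fin q) (Fin r) ℝ)
    (Tt : Matrix (Fin r) (Fin r) ℝ) (Ω : Matrix (Fin d) (Fin n) ℝ)
    (hdec : A * fromCols Uq Ut =
      fromCols Uq Ut * fromBlocks Tqq T12 0 Tt + vecMulVec u (Sum.elim bq bt))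
    (horth : SketchOrthonormal Ω (fromCols (fromCols Uq Ut) (replicateCol (Fin 1) u)))
    (hb : bq = 0) :
    A * Uq = Uq * Tqq ∧
      (∀ y : Fin q → ℝ, A.mulVec (Uq.mulVec y) ∈ LinearMap.range Uq.mulVecLin) ∧
      (1 - Uq * (Ω * Uq)ᵀ * Ω) * A * Ut = Ut * Tt + vecMulVec u bt := by
  subst hb
  have e1 : A * Uq = Uq * Tqq := by
    ext i j
    have h := congrFun (congrFun hdec i) (Sum.inl j)
    simpa [Matrix.mul_apply, vecMulVec_apply] using h
  have e2 : A * Ut = Uq * T12 + Ut * Tt + vecMulVec u bt := by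
    ext i j
    have h := congrFun (congrFun hdec i) (Sum.inr j)
    simpa [Matrix.mul_apply, vecMulVec_apply] using h
  unfold SketchOrthonormal at horth
  have o1 : (Ω * Uq)ᵀ * (Ω * Uq) = 1 := by
    ext i j
    have h := congrFun (congrFun horth (Sum.inl (Sum.inl i))) (Sum.inl (Sum.inl j))
    simpa [-transpose_mul, Matrix.mul_apply, Matrix.one_apply] using h
  have o2 : (Ω * Uq)ᵀ * (Ω * Ut) = 0 := by
    ext i j
    have h := congrFun (congrFun horth (Sum.inl (Sum.inl i))) (Sum.inl (Sum.inr j))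
    simpa [-transpose_mul, Matrix.mul_apply, Matrix.one_apply] using h
  have o3 : (Ω * Uq)ᵀ * (Ω * replicateCol (Fin 1) u) = 0 := by
    ext i j
    have h := congrFun (congrFun horth (Sum.inl (Sum.inl i))) (Sum.inr j)
    simpa [-transpose_mul, Matrix.mul_apply, Matrix.one_apply] using h
  have hv : vecMulVec u bt = replicateCol (Fin 1) u * replicateRow (Fin 1) bt :=
    vecMulVec_eq (Fin 1) u bt
  refine ⟨e1, fun y => ⟨Tqq.mulVec y, ?_⟩, ?_⟩
  · simp only [mulVecLin_apply, mulVec_mulVec, e1]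
  · have k : (Ω * Uq)ᵀ * (Ω * (A * Ut)) = T12 := by
      rw [e2, hv, Matrix.mul_add, Matrix.mul_add, Matrix.mul_add, Matrix.mul_add,
        ← Matrix.mul_assoc Ω, ← Matrix.mul_assoc Ω, ← Matrix.mul_assoc Ω,
        ← Matrix.mul_assoc, ← Matrix.mul_assoc _ (Ω * Ut),
        ← Matrix.mul_assoc _ (Ω * replicateCol (Fin 1) u), o1, o2, o3]
      simp
    rw [Matrix.mul_assoc, Matrix.sub_mul, Matrix.one_mul, Matrix.mul_assoc, Matrix.mul_assoc, k, e2]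
    abel
end

section
/- Let A ∈ ℝ^{n×n}, let U ∈ ℝ^{n×k} be sketch-orthonormal with respect to Ω ∈ ℝ^{d×n}, and suppose A·U = U·T where T = [[T_qq, T₁₂],[0, T₂₂]] with T_qq ∈ ℝ^{q×q}. Write U = (U_q U_{k−q}) conformally and define A_q := (I − U_q·(Ω·U_q)ᵀ·Ω)·A. Then A_q·U = U·[[0, 0],[0, T₂₂]]; that is, the columns of U are sketch-orthonormal Schur vectors of A_q, and the eigenvalues of the associated triangular factor in the first q positions are replaced by 0 while those of T₂₂ are preserved. -/
open Matrix

theorem stmt_13 {n q r d : ℕ} (A : Matrix (Fin n) (Fin n) ℝ)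
    (Uq : Matrix (Fin n) (Fin q) ℝ) (Ur : Matrix (Fin n) (Fin r) ℝ)
    (Tqq : Matrix (Fin q) (Fin q) ℝ) (T12 : Matrix (Fin q) (Fin r) ℝ)
    (T22 : Matrix (Fin r) (Fin r) ℝ) (Ω : Matrix (Fin d) (Fin n) ℝ)
    (horth : SketchOrthonormal Ω (fromCols Uq Ur))
    (hSchur : A * fromCols Uq Ur = fromCols Uq Ur * fromBlocks Tqq T12 0 T22)
    (Aq : Matrix (Fin n) (Fin n) ℝ)
    (hAq : Aq = (1 - Uq * (Ω * Uq)ᵀ * Ω) * A) :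
    Aq * fromCols Uq Ur = fromCols Uq Ur * fromBlocks 0 0 0 T22 := by
  have h : (Ω * fromCols Uq Ur)ᵀ * (Ω * fromCols Uq Ur) = 1 := horth
  rw [mul_fromCols, transpose_fromCols, fromRows_mul_fromCols, ← fromBlocks_one,
    fromBlocks_inj] at h
  obtain ⟨h1, h2, -, -⟩ := h
  have e1 : (1 - Uq * (Ω * Uq)ᵀ * Ω) * Uq = 0 := by
    rw [Matrix.sub_mul, Matrix.one_mul, Matrix.mul_assoc, Matrix.mul_assoc, h1,
      Matrix.mul_one, sub_self]
  have e2 : (1 - Uq * (Ω * Uq)ᵀ * Ω) * Ur = Ur := by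
    rw [Matrix.sub_mul, Matrix.one_mul, Matrix.mul_assoc, Matrix.mul_assoc, h2,
      Matrix.mul_zero, sub_zero]
  rw [hAq, Matrix.mul_assoc, hSchur, ← Matrix.mul_assoc, mul_fromCols, e1, e2,
    fromCols_mul_fromBlocks]
  refine Eq.trans ?_ (fromCols_mul_fromBlocks Uq Ur 0 0 0 T22).symm
  simp
end

section
/- Let A ∈ ℝ^{n×n}, let U_q ∈ ℝ^{n×q} be sketch-orthonormal with respect to Ω ∈ ℝ^{d×n} and satisfy A·U_q = U_q·T_qq. Define A_q := (I − U_q·(Ω·U_q)ᵀ·Ω)·A, and suppose U_r ∈ ℝ^{n×r} is sketch-orthonormal with A_q·U_r = U_r·T_r where T_r ∈ ℝ^{r×r} is invertible. Then: (i) (Ω·U_q)ᵀ·(Ω·U_r) = 0, so the columns of (U_q U_r) are mutually sketch-orthonormal; and (ii) A·U_r = U_r·T_r + U_q·C with C := (Ω·U_q)ᵀ·Ω·A·U_r, so the column span of (U_q U_r) is invariant under A and its columns are sketch-orthonormal Schur vectors of A. -/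
open Matrix

theorem stmt_14 {n q r d : ℕ} (A : Matrix (Fin n) (Fin n) ℝ)
    (Uq : Matrix (Fin n) (Fin q) ℝ) (Tqq : Matrix (Fin q) (Fin q) ℝ)
    (Ω : Matrix (Fin d) (Fin n) ℝ)
    (horthq : SketchOrthonormal Ω Uq) (hSchurq : A * Uq = Uq * Tqq)
    (Aq : Matrix (Fin n) (Fin n) ℝ)
    (hAq : Aq = (1 - Uq * (Ω * Uq)ᵀ * Ω) * A)
    (Ur : Matrix (Fin n) (Fin r) ℝ) (Tr : Matrix (Fin r) (Fin r) ℝ)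
    (horthr : SketchOrthonormal Ω Ur) (hSchurr : Aq * Ur = Ur * Tr)
    (hTr : IsUnit Tr) :
    (Ω * Uq)ᵀ * (Ω * Ur) = 0 ∧
      A * Ur = Ur * Tr + Uq * ((Ω * Uq)ᵀ * (Ω * A * Ur)) ∧
      SketchOrthonormal Ω (fromCols Uq Ur) ∧
      A * fromCols Uq Ur =
        fromCols Uq Ur * fromBlocks Tqq ((Ω * Uq)ᵀ * (Ω * A * Ur)) 0 Tr := by
  subst hAq
  unfold SketchOrthonormal at *
  have h2 : A * Ur = Ur * Tr + Uq * ((Ω * Uq)ᵀ * (Ω * A * Ur)) := by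
    rw [← hSchurr]
    simp only [Matrix.sub_mul, Matrix.one_mul, Matrix.mul_assoc, sub_add_cancel]
  have h0 : ((Ω * Uq)ᵀ * (Ω * Ur)) * Tr = 0 := by
    have e : ((Ω * Uq)ᵀ * (Ω * Ur)) * Tr = (Ω * Uq)ᵀ * (Ω * (Ur * Tr)) := by
      simp only [Matrix.mul_assoc]
    have e2 : Ur * Tr = A * Ur - Uq * ((Ω * Uq)ᵀ * (Ω * A * Ur)) :=
      eq_sub_of_add_eq h2.symm
    rw [e, e2, Matrix.mul_sub, Matrix.mul_sub, ← Matrix.mul_assoc Ω Uq,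
      ← Matrix.mul_assoc (Ω * Uq)ᵀ (Ω * Uq), horthq, Matrix.one_mul,
      ← Matrix.mul_assoc Ω A, sub_self]
  have h1 : (Ω * Uq)ᵀ * (Ω * Ur) = 0 := by
    have hd : IsUnit Tr.det := (Matrix.isUnit_iff_isUnit_det Tr).1 hTr
    rw [← Matrix.mul_nonsing_inv_cancel_right Tr ((Ω * Uq)ᵀ * (Ω * Ur)) hd, h0,
      Matrix.zero_mul]
  have h1' : (Ω * Ur)ᵀ * (Ω * Uq) = 0 := by
    have := congrArg Matrix.transpose h1
    rwa [Matrix.transpose_mul, Matrix.transpose_transpose, Matrix.transpose_zero] at this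
  refine ⟨h1, h2, ?_, ?_⟩
  · rw [Matrix.mul_fromCols, Matrix.transpose_fromCols, Matrix.fromRows_mul_fromCols,
      horthq, horthr, h1, h1', Matrix.fromBlocks_one]
  · rw [Matrix.mul_fromCols, Matrix.fromCols_mul_fromBlocks, Matrix.mul_zero, add_zero,
      hSchurq, add_comm (Uq * _), ← h2]
end

section
/- Let A ∈ ℝ^{n×n} and let A·(U_q Ũ) = (U_q Ũ)·[[T_qq, T₁₂],[0, T̃]] + u·(bᵀ b̃ᵀ) be a partitioned randomized Krylov–Schur factorization, where (U_q Ũ u) is sketch-orthonormal with respect to an ε-embedding Ω ∈ ℝ^{d×n} (0 ≤ ε < 1) for the column span of (U_q Ũ u), b ∈ ℝ^q. Suppose |b_i| ≤ η for i = 1, …, q. If (λ, y) is an eigenpair of T_qq with ‖y‖ = 1, then ‖A·(U_q·y) − λ·(U_q·y)‖ ≤ (√q / √(1−ε))·η. -/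
open Matrix

theorem eNorm_sq' {n : ℕ} (x : Fin n → ℝ) : eNorm x ^ 2 = ∑ i, x i ^ 2 := by
  unfold eNorm
  rw [EuclideanSpace.norm_sq_eq]
  simp

theorem eNorm_nonneg' {n : ℕ} (x : Fin n → ℝ) : 0 ≤ eNorm x := norm_nonneg _

theorem stmt_16 {n q r d : ℕ} (ε : ℝ) (hε0 : 0 ≤ ε) (hε1 : ε < 1)
    (A : Matrix (Fin n) (Fin n) ℝ)
    (Uq : Matrix (Fin n) (Fin q) ℝ) (Ut : Matrix (Fin n) (Fin r) ℝ)
    (u : Fin n → ℝ) (b : Fin q → ℝ) (bt : Fin r → ℝ)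
    (Tqq : Matrix (Fin q) (Fin q) ℝ) (T12 : Matrix (Fin q) (Fin r) ℝ)
    (Tt : Matrix (Fin r) (Fin r) ℝ) (Ω : Matrix (Fin d) (Fin n) ℝ)
    (hdec : A * fromCols Uq Ut =
      fromCols Uq Ut * fromBlocks Tqq T12 0 Tt + vecMulVec u (Sum.elim b bt))
    (horth : SketchOrthonormal Ω (fromCols (fromCols Uq Ut) (replicateCol (Fin 1) u)))
    (hemb : IsEpsEmbedding Ω ε
      (Set.range (fromCols (fromCols Uq Ut) (replicateCol (Fin 1) u)).mulVec))
    (η : ℝ) (hb : ∀ i : Fin q, |b i| ≤ η)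
    (lam : ℝ) (y : Fin q → ℝ) (heig : Tqq.mulVec y = lam • y) (hy : eNorm y = 1) :
    eNorm (A.mulVec (Uq.mulVec y) - lam • Uq.mulVec y) ≤
      (Real.sqrt q / Real.sqrt (1 - ε)) * η := by
  have hq : 0 < q := by
    rcases Nat.eq_zero_or_pos q with h | h
    · subst h
      have := eNorm_sq' y
      rw [hy] at this
      simp at this
    · exact h
  have hη : 0 ≤ η := (abs_nonneg _).trans (hb ⟨0, hq⟩)
  have h1 : A.mulVec (Uq.mulVec y) - lam • Uq.mulVec y = (b ⬝ᵥ y) • u := by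
    have h := congrArg (fun M => M.mulVec (Sum.elim y (0 : Fin r → ℝ))) hdec
    simp only [Matrix.add_mulVec, ← Matrix.mulVec_mulVec, Matrix.fromBlocks_mulVec,
      Matrix.fromCols_mulVec] at h
    simp only [Sum.elim_comp_inl, Sum.elim_comp_inr, heig, Matrix.mulVec_zero, add_zero,
      Matrix.mulVec_smul] at h
    have e : (vecMulVec u (Sum.elim b bt)).mulVec (Sum.elim y (0 : Fin r → ℝ))
        = (b ⬝ᵥ y) • u := by
      ext i
      simp [Matrix.mulVec, dotProduct, vecMulVec_apply, Finset.mul_sum, mul_comm,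
        mul_assoc]
    rw [e] at h
    rw [h]; simp
  have hu : (1 - ε) * eNorm u ^ 2 ≤ 1 := by
    have hm : (fromCols (fromCols Uq Ut) (replicateCol (Fin 1) u)).mulVec
        (Pi.single (Sum.inr 0) 1) = u := by
      rw [Matrix.mulVec_single_one]
      ext i
      simp [Matrix.col_apply]
    have h2 := (hemb u ⟨_, hm⟩).1
    have h3 : eNorm (Ω.mulVec u) ^ 2 = 1 := by
      have h4 := congrFun (congrFun horth (Sum.inr 0)) (Sum.inr 0)
      rw [eNorm_sq']
      simpa [Matrix.mul_apply, Matrix.mulVec, dotProduct, pow_two] using h4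
    linarith
  have hby : (b ⬝ᵥ y) ^ 2 ≤ q * η ^ 2 := by
    have hy2 : ∑ i, y i ^ 2 = 1 := by rw [← eNorm_sq', hy]; norm_num
    have h5 : (b ⬝ᵥ y) ^ 2 ≤ (∑ i, b i ^ 2) * ∑ i, y i ^ 2 :=
      Finset.sum_mul_sq_le_sq_mul_sq _ _ _
    rw [hy2, mul_one] at h5
    refine h5.trans ?_
    have h6 : ∑ i, b i ^ 2 ≤ ∑ _i : Fin q, η ^ 2 :=
      Finset.sum_le_sum fun i _ => sq_le_sq' (neg_le_of_abs_le (hb i)) (le_of_abs_le (hb i))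
    simpa using h6
  have hp : 0 < 1 - ε := by linarith
  rw [h1]
  refine (sq_le_sq₀ (eNorm_nonneg' _) (by positivity)).1 ?_
  have h7 : eNorm ((b ⬝ᵥ y) • u) ^ 2 = (b ⬝ᵥ y) ^ 2 * eNorm u ^ 2 := by
    simp only [eNorm_sq', Finset.mul_sum, Pi.smul_apply, smul_eq_mul, mul_pow]
  rw [h7, mul_pow, div_pow, Real.sq_sqrt (by positivity), Real.sq_sqrt hp.le]
  have h8 : eNorm u ^ 2 ≤ 1 / (1 - ε) := by
    rw [le_div_iff₀ hp]; linarith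
  calc _ ≤ (q * η ^ 2) * (1 / (1 - ε)) := by gcongr
    _ = _ := by ring
end
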